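/- Fix an integer q ≥ 5. For all n ≥ 1, the numbers a_n of type-A vertices and b_n of type-B vertices in row n of the hyperbolic Pascal triangle {4,q} satisfy the coupled recurrences a_{n+1} = a_n + b_n + 1 and b_{n+1} = (q−4)·a_n + (q−3)·b_n, with a_1 = 0, b_1 = 0. -/

import Mathlib

/-- Type of a vertex in a hyperbolic Pascal triangle: winger, A, or B. -/
inductive HVType where
  | W : HVType
  | A : HVType
  | B : HVType
deriving DecidableEq, Repr

/-- Number of type-B children produced by a vertex of the given type
in the hyperbolic Pascal triangle `{4,q}`. -/
def hBCount (q : ℕ) : HVType → ℕ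
  | .A => q - 4
  | .B => q - 3
  | .W => 0

/-- The inner part of the next row: for each pair of consecutive vertices a shared
type-A child whose value is the sum of the parents' values, followed by the
type-B copies of the right parent. -/
def hMid (q : ℕ) : List (HVType × ℕ) → List (HVType × ℕ)
  | a :: b :: rest =>
      (HVType.A, a.2 + b.2) ::
        (List.replicate (hBCount q b.1) (HVType.B, b.2) ++ hMid q (b :: rest))
  | _ => []

/-- Row `n` of the hyperbolic Pascal triangle `{4,q}`, as a list of
(type, value) pairs read from left to right. -/
def hRow (q : ℕ) : ℕ → List (HVType × ℕ)
  | 0 => [(HVType.W, 1)]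
  | n + 1 => (HVType.W, 1) :: (hMid q (hRow q n) ++ [(HVType.W, 1)])

/-- Number of type-A vertices of row `n`. -/
def hCountA (q n : ℕ) : ℕ := ((hRow q n).filter (fun v => v.1 = HVType.A)).length

/-- Number of type-B vertices of row `n`. -/
def hCountB (q n : ℕ) : ℕ := ((hRow q n).filter (fun v => v.1 = HVType.B)).length

/-- Sum of the values of the type-A vertices of row `n`. -/
def hSumA (q n : ℕ) : ℕ :=
  (((hRow q n).filter (fun v => v.1 = HVType.A)).map Prod.snd).sum

/-- Sum of the values of the type-B vertices of row `n`. -/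
def hSumB (q n : ℕ) : ℕ :=
  (((hRow q n).filter (fun v => v.1 = HVType.B)).map Prod.snd).sum

/-- The number `s_n` of vertices of row `n`. -/
def hLen (q n : ℕ) : ℕ := (hRow q n).length

/-- The value of the `k`-th (0-indexed) vertex of row `n`. -/
def hVal (q n k : ℕ) : ℕ := ((hRow q n).getD k (HVType.W, 0)).2

/-- The type of the `k`-th (0-indexed) vertex of row `n`. -/
def hType (q n k : ℕ) : HVType := ((hRow q n).getD k (HVType.W, 0)).1

theorem length_filter_A_hMid (q : ℕ) (a : HVType × ℕ) (l : List (HVType × ℕ)) :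
    ((hMid q (a :: l)).filter (fun v => v.1 = HVType.A)).length = l.length := by
  induction l generalizing a with
  | nil => simp [hMid]
  | cons b l ih => simp [hMid, ih]

theorem length_filter_B_hMid (q : ℕ) (a : HVType × ℕ) (l : List (HVType × ℕ)) :
    ((hMid q (a :: l)).filter (fun v => v.1 = HVType.B)).length =
      (q - 4) * (l.filter (fun v => v.1 = HVType.A)).length +
        (q - 3) * (l.filter (fun v => v.1 = HVType.B)).length := by
  induction l generalizing a with
  | nil => simp [hMid]
  | cons b l ih =>
    obtain ⟨t, x⟩ := b
    cases t <;> simp [hMid, ih, hBCount] <;> ring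

theorem length_hMid (q : ℕ) (l : List (HVType × ℕ)) :
    (hMid q l).length =
      ((hMid q l).filter (fun v => v.1 = HVType.A)).length +
        ((hMid q l).filter (fun v => v.1 = HVType.B)).length := by
  fun_induction hMid q l with
  | case1 a b l ih =>
    simp only [List.length_cons, List.length_append, ih]
    simp
    omega
  | case2 => simp

theorem hCountA_succ (q n : ℕ) :
    hCountA q (n + 1) =
      ((hMid q (hRow q n)).filter (fun v => v.1 = HVType.A)).length := by
  simp [hCountA, hRow]

theorem hCountB_succ (q n : ℕ) :
    hCountB q (n + 1) =
      ((hMid q (hRow q n)).filter (fun v => v.1 = HVType.B)).length := by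
  simp [hCountB, hRow]

/-- For `q ≥ 5`, the numbers of type-A and type-B vertices in the rows of
the hyperbolic Pascal triangle `{4,q}` satisfy `a_{n+1} = a_n + b_n + 1` and
`b_{n+1} = (q-4)·a_n + (q-3)·b_n` for `n ≥ 1`, with `a_1 = 0`, `b_1 = 0`. -/
theorem stmt_0 (q : ℕ) (hq : 5 ≤ q) :
    hCountA q 1 = 0 ∧ hCountB q 1 = 0 ∧
    ∀ n, 1 ≤ n →
      hCountA q (n + 1) = hCountA q n + hCountB q n + 1 ∧
      hCountB q (n + 1) = (q - 4) * hCountA q n + (q - 3) * hCountB q n := by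
  refine ⟨by simp [hCountA, hRow, hMid], by simp [hCountB, hRow, hMid], fun n hn => ?_⟩
  obtain ⟨m, rfl⟩ := Nat.exists_eq_add_of_le' hn
  rw [hCountA_succ q (m + 1), hCountB_succ q (m + 1), hCountA_succ q m, hCountB_succ q m, hRow,
    length_filter_A_hMid, length_filter_B_hMid]
  refine ⟨by simp [length_hMid q (hRow q m)], by simp⟩
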